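/- The map f(x) = b((1+x)/(a+x))², with a > 1/2, a ≠ 1, b > 0, has no 2-periodic points other than fixed points: there is no x > 0 with f(f(x)) = x and f(x) ≠ x. -/

import Mathlib

theorem no_two_periodic_points (a b : ℝ) (ha : 1 / 2 < a) (ha1 : a ≠ 1) (hb : 0 < b)
    (f : ℝ → ℝ) (hf : ∀ x : ℝ, f x = b * ((1 + x) / (a + x)) ^ 2) :
    ¬ ∃ x : ℝ, 0 < x ∧ f (f x) = x ∧ f x ≠ x := by
  rintro ⟨x, hx, h2, hne⟩
  obtain ⟨r, hr, rfl⟩ : ∃ r : ℝ, 0 < r ∧ b = r ^ 2 :=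
    ⟨√b, Real.sqrt_pos.mpr hb, (Real.sq_sqrt hb.le).symm⟩
  have ha0 : 0 < a := by linarith
  obtain ⟨t, ht⟩ : ∃ t, t = r * ((1 + x) / (a + x)) := ⟨_, rfl⟩
  have htpos : 0 < t := by rw [ht]; positivity
  have hfx : f x = t ^ 2 := by rw [hf, ht]; ring
  rw [hfx] at h2 hne
  obtain ⟨s, hs⟩ : ∃ s, s = r * ((1 + t ^ 2) / (a + t ^ 2)) := ⟨_, rfl⟩
  have hspos : 0 < s := by rw [hs]; positivity
  have hxs : x = s ^ 2 := by rw [← h2, hf, hs]; ring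
  subst hxs
  have hst : s - t ≠ 0 := by
    intro h
    apply hne
    rw [sub_eq_zero.mp h]
  have e1 : t * (a + s ^ 2) = r * (1 + s ^ 2) := by
    have : a + s ^ 2 ≠ 0 := by positivity
    field_simp at ht
    linarith
  have e2 : s * (a + t ^ 2) = r * (1 + t ^ 2) := by
    have : a + t ^ 2 ≠ 0 := by positivity
    field_simp at hs
    linarith
  have q : s * t = a + r * (s + t) := by
    apply mul_left_cancel₀ hst
    linear_combination e1 - e2
  have p : (s + t) * (a + r ^ 2) = r * (1 - a) := by
    linear_combination (e1 + e2) / 2 - ((s + t) / 2 + r) * q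
  have h4 : 4 * r < s + t := by
    have : 0 < (s + t) * (s + t - 4 * r) := by nlinarith [sq_nonneg (s - t)]
    have := pos_of_mul_pos_right this (by positivity)
    linarith
  have h5 : 4 * r * (a + r ^ 2) < r * (1 - a) := by
    rw [← p]
    exact mul_lt_mul_of_pos_right h4 (by positivity)
  have h6 : 4 * (a + r ^ 2) < 1 - a := by
    apply lt_of_mul_lt_mul_left _ hr.le
    linarith
  nlinarith [sq_nonneg r]
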